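/- arXiv:2311.07128 — 3 statements merged into one kernel-verified Lean document; each statement's English description precedes it below -/
import Mathlib

section
/- Consider any TDMA schedule for K UEs with AoI sequences A_1, …, A_K. For every time t ≥ 0, the instantaneous sum AoI satisfies Σ_{k=1}^{K} A_k(t) ≥ m(m+1)/2 + (K − m)(t + 1), where m = min(t, K). In particular, for every t ≥ K, Σ_{k=1}^{K} A_k(t) ≥ K(K+1)/2. -/
open scoped Classical in
/-- The AoI sequence of a UE with successful-update slot set `S ⊆ {1, 2, …}`:
`A 0 = 1`, and for `t ≥ 1`, `A t = 1` if `t ∈ S` and `A t = A (t-1) + 1` otherwise. -/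
noncomputable def aoi (S : Set ℕ) : ℕ → ℕ
  | 0 => 1
  | t + 1 => if t + 1 ∈ S then 1 else aoi S t + 1

theorem aoi_pos (S : Set ℕ) (t : ℕ) : 0 < aoi S t := by
  cases t with
  | zero => simp [aoi]
  | succ t => rw [aoi]; split_ifs <;> omega

/-- An AoI of at most `t` at time `t` reveals the slot of the latest update. -/
theorem sub_aoi_mem (S : Set ℕ) (t : ℕ) (h : aoi S t ≤ t) : t + 1 - aoi S t ∈ S := by
  induction t with
  | zero => simp [aoi] at h
  | succ t ih =>
    rw [aoi] at h ⊢
    split_ifs at h ⊢ with hmem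
    · simpa using hmem
    · have := ih (by omega)
      rwa [Nat.add_sub_add_right]

/-- Positive integers that are pairwise distinct wherever they are at most `t` sum to at least
`1 + 2 + ⋯`, with summands truncated at `t + 1`. -/
theorem sum_range_min_le_sum {ι : Type*} (g : ι → ℕ) (t : ℕ) (hpos : ∀ i, 0 < g i)
    (hinj : Set.InjOn g {i | g i ≤ t}) (s : Finset ι) :
    ∑ i ∈ Finset.range s.card, min (i + 1) (t + 1) ≤ ∑ i ∈ s, g i := by
  classical
  obtain ⟨n, hn⟩ : ∃ n, s.card = n := ⟨_, rfl⟩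
  induction n generalizing s with
  | zero => simp [hn]
  | succ n ih =>
    obtain ⟨a, ha, hmin⟩ : ∃ a ∈ s, min (n + 1) (t + 1) ≤ g a := by
      by_contra! hlt
      have hmaps : ∀ i ∈ s, g i ∈ Finset.Icc 1 n := fun i hi => by
        have := hlt i hi
        have := hpos i
        rw [Finset.mem_Icc]
        omega
      have hcard := Finset.card_le_card_of_injOn g hmaps
        (hinj.mono fun i hi => by
          have := hlt i hi
          rw [Set.mem_ofPred_eq]
          omega)
      simp [hn] at hcard
    have hcard : (s.erase a).card = n := by rw [Finset.card_erase_of_mem ha, hn]; rfl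
    have hsum := ih (s.erase a) hcard
    rw [hcard] at hsum
    rw [hn, Finset.sum_range_succ, ← Finset.sum_erase_add s g ha]
    exact Nat.add_le_add hsum hmin

theorem sum_range_min (K t : ℕ) :
    ∑ i ∈ Finset.range K, min (i + 1) (t + 1) =
      min t K * (min t K + 1) / 2 + (K - min t K) * (t + 1) := by
  induction K with
  | zero => simp
  | succ K ih =>
    rw [Finset.sum_range_succ, ih]
    rcases lt_or_ge K t with h | h
    · have hsq : (K + 1) * (K + 1 + 1) = K * (K + 1) + 2 * (K + 1) := by ring
      rw [min_eq_right h.le, min_eq_right (show K + 1 ≤ t from h),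
        min_eq_left (show K + 1 ≤ t + 1 by omega), hsq]
      simp only [Nat.sub_self, zero_mul]
      omega
    · rw [min_eq_left h, min_eq_left (show t ≤ K + 1 by omega),
        min_eq_right (show t + 1 ≤ K + 1 by omega), Nat.sub_add_comm h]
      ring

/-- **TDMA lower bound on the instantaneous sum AoI.** For any TDMA schedule for `K`
UEs (pairwise disjoint successful-update slot sets), at every time `t` the sum AoI
is at least `m(m+1)/2 + (K - m)(t + 1)` with `m = min t K`; in particular, for
`t ≥ K` it is at least `K(K+1)/2`. -/
theorem stmt6 {K : ℕ} (S : Fin K → Set ℕ) (hS0 : ∀ k, 0 ∉ S k)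
    (hdisj : ∀ j k : Fin K, j ≠ k → Disjoint (S j) (S k)) (t : ℕ) :
    (∑ k : Fin K, aoi (S k) t ≥ min t K * (min t K + 1) / 2 + (K - min t K) * (t + 1)) ∧
    (K ≤ t → ∑ k : Fin K, aoi (S k) t ≥ K * (K + 1) / 2) := by
  have hinj : Set.InjOn (fun k => aoi (S k) t) {k | aoi (S k) t ≤ t} := by
    intro j hj k hk hjk
    by_contra hne
    refine Set.disjoint_left.mp (hdisj j k hne) (sub_aoi_mem (S j) t hj) ?_
    rw [show aoi (S j) t = aoi (S k) t from hjk]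
    exact sub_aoi_mem (S k) t hk
  have hsum := sum_range_min_le_sum _ t (fun k => aoi_pos (S k) t) hinj Finset.univ
  rw [Finset.card_univ, Fintype.card_fin, sum_range_min] at hsum
  refine ⟨hsum, fun hK => ?_⟩
  simpa [min_eq_right hK] using hsum
end

section
/- Under the round-robin schedule for K UEs, for every time t ≥ 0 the instantaneous sum AoI attains the TDMA lower bound with equality: Σ_{k=1}^{K} A_k(t) = m(m+1)/2 + (K − m)(t + 1), where m = min(t, K). In particular, Σ_{k=1}^{K} A_k(t) = K(K+1)/2 for every t ≥ K. -/
/-- The round-robin successful-update slot set of UE `k` (for `1 ≤ k ≤ K`):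
the slots `t ≥ k` with `t ≡ k (mod K)`, i.e. `{k, k + K, k + 2K, …}`. -/
def rrSet (K k : ℕ) : Set ℕ := {t | k ≤ t ∧ t % K = k % K}

lemma mem_rrSet_iff {K k t : ℕ} (hk : k ∈ Finset.Icc 1 K) :
    t + 1 ∈ rrSet K k ↔ k ≤ t + 1 ∧ k = t % K + 1 := by
  obtain ⟨h1, h2⟩ := Finset.mem_Icc.mp hk
  have hlt : t % K < K := Nat.mod_lt _ (by omega)
  have hmod : (t + 1) % K = (t % K + 1) % K := by simp
  simp only [rrSet, Set.mem_ofPred_eq, hmod]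
  refine and_congr_right fun _ => ⟨fun h => ?_, fun h => by rw [h]⟩
  rcases h2.eq_or_lt with rfl | h2
  · rw [Nat.mod_self] at h
    rcases (Nat.succ_le_of_lt hlt).eq_or_lt with h' | h'
    · exact h'.symm
    · rw [Nat.mod_eq_of_lt h'] at h
      omega
  · rw [Nat.mod_eq_of_lt h2] at h
    rcases (Nat.succ_le_of_lt hlt).eq_or_lt with h' | h'
    · rw [Nat.succ_eq_add_one] at h'
      rw [h', Nat.mod_self] at h
      omega
    · rw [Nat.mod_eq_of_lt h'] at h
      exact h.symm

/-- A slot serves exactly the UE whose index is its residue class. -/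
lemma mem_rrSet_iff_eq {K k t : ℕ} (hk : k ∈ Finset.Icc 1 K) :
    t + 1 ∈ rrSet K k ↔ k = t % K + 1 := by
  rw [mem_rrSet_iff hk, and_iff_right_iff_imp]
  have := Nat.mod_le t K
  omega

lemma aoi_succ_rrSet {K k : ℕ} (t : ℕ) (hk : k ∈ Finset.Icc 1 K) :
    aoi (rrSet K k) (t + 1) = if k = t % K + 1 then 1 else aoi (rrSet K k) t + 1 := by
  simp only [aoi, mem_rrSet_iff_eq hk]

lemma aoi_rrSet_of_lt {K k t : ℕ} (hk : k ∈ Finset.Icc 1 K) (ht : t < k) :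
    aoi (rrSet K k) t = t + 1 := by
  induction t with
  | zero => rfl
  | succ t ih =>
    have := Nat.mod_le t K
    rw [aoi_succ_rrSet t hk, if_neg (by omega), ih (by omega)]

lemma aoi_rrSet_add {K k j : ℕ} (q : ℕ) (hk : k ∈ Finset.Icc 1 K) (hj : j < K) :
    aoi (rrSet K k) (K * q + k + j) = j + 1 := by
  obtain ⟨h1, h2⟩ := Finset.mem_Icc.mp hk
  induction j with
  | zero =>
    have hmod : (K * q + (k - 1)) % K = k - 1 := by
      rw [Nat.mul_add_mod, Nat.mod_eq_of_lt (by omega)]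
    have hslot : K * q + k + 0 = K * q + (k - 1) + 1 := by omega
    rw [hslot, aoi_succ_rrSet _ hk, if_pos (by omega)]
  | succ j ih =>
    have hne : k ≠ (K * q + k + j) % K + 1 := by
      rw [Nat.add_assoc, Nat.mul_add_mod]
      rcases lt_or_ge (k + j) K with h | h
      · rw [Nat.mod_eq_of_lt h]
        omega
      · rw [Nat.mod_eq_sub_mod h, Nat.mod_eq_of_lt (by omega)]
        omega
    rw [← Nat.add_assoc, aoi_succ_rrSet _ hk, if_neg hne, ih (by omega)]

/-- The age of a UE just before it is served. -/
lemma aoi_rrSet_served {K : ℕ} (t : ℕ) (hK : 0 < K) :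
    aoi (rrSet K (t % K + 1)) t = min (t + 1) K := by
  have hlt := Nat.mod_lt t hK
  have hk : t % K + 1 ∈ Finset.Icc 1 K := Finset.mem_Icc.mpr ⟨by omega, hlt⟩
  rcases lt_or_ge t K with h | h
  · rw [aoi_rrSet_of_lt hk (by rw [Nat.mod_eq_of_lt h]; omega), min_eq_left h]
  · have hdiv := Nat.div_add_mod t K
    obtain ⟨q, hq⟩ : ∃ q, t / K = q + 1 :=
      Nat.exists_eq_succ_of_ne_zero (Nat.div_pos h hK).ne'
    rw [hq, Nat.mul_succ] at hdiv
    have ht : t = K * q + (t % K + 1) + (K - 1) := by omega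
    have hage := aoi_rrSet_add (j := K - 1) q hk (by omega)
    rw [← ht] at hage
    omega

lemma sum_aoi_rrSet_succ {K : ℕ} (t : ℕ) (hK : 0 < K) :
    ∑ k ∈ Finset.Icc 1 K, aoi (rrSet K k) (t + 1) + min (t + 1) K
      = ∑ k ∈ Finset.Icc 1 K, aoi (rrSet K k) t + K := by
  have hk : t % K + 1 ∈ Finset.Icc 1 K := Finset.mem_Icc.mpr ⟨by omega, Nat.mod_lt t hK⟩
  calc
    _ = ∑ k ∈ Finset.Icc 1 K, (aoi (rrSet K k) (t + 1)
          + if k = t % K + 1 then aoi (rrSet K k) t else 0) := by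
      rw [Finset.sum_add_distrib, Finset.sum_ite_eq_of_mem' _ _ _ hk, aoi_rrSet_served t hK]
    _ = ∑ k ∈ Finset.Icc 1 K, (aoi (rrSet K k) t + 1) := by
      refine Finset.sum_congr rfl fun k hk => ?_
      rw [aoi_succ_rrSet t hk]
      split_ifs <;> omega
    _ = _ := by simp [Finset.sum_add_distrib]

lemma sum_aoi_rrSet (K t : ℕ) :
    ∑ k ∈ Finset.Icc 1 K, aoi (rrSet K k) t
      = min t K * (min t K + 1) / 2 + (K - min t K) * (t + 1) := by
  rcases K.eq_zero_or_pos with rfl | hK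
  · simp
  induction t with
  | zero => simp [aoi]
  | succ t ih =>
    have hstep := sum_aoi_rrSet_succ t hK
    rw [ih] at hstep
    rcases lt_or_ge t K with h | h
    · obtain ⟨d, rfl⟩ := Nat.exists_eq_add_of_lt h
      rw [min_eq_left (by omega), min_eq_left (by omega)] at hstep
      rw [min_eq_left (by omega)]
      have htri : (t + 1) * (t + 1 + 1) / 2 = t * (t + 1) / 2 + (t + 1) := by
        rw [show (t + 1) * (t + 1 + 1) = t * (t + 1) + (t + 1) * 2 by ring,
          Nat.add_mul_div_right _ _ two_pos]
      rw [htri, show t + d + 1 - (t + 1) = d by omega]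
      rw [show t + d + 1 - t = d + 1 by omega] at hstep
      linarith
    · rw [min_eq_right (by omega), min_eq_right h] at hstep
      rw [min_eq_right (by omega)]
      simp only [Nat.sub_self, Nat.zero_mul] at hstep ⊢
      omega

/-- **Round-robin attains the TDMA sum-AoI lower bound with equality.** For every
`t`, the instantaneous sum AoI equals `m(m+1)/2 + (K - m)(t + 1)` with
`m = min t K`; in particular it equals `K(K+1)/2` for all `t ≥ K`. -/
theorem stmt9 (K t : ℕ) :
    (∑ k ∈ Finset.Icc 1 K, aoi (rrSet K k) t
      = min t K * (min t K + 1) / 2 + (K - min t K) * (t + 1)) ∧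
    (K ≤ t → ∑ k ∈ Finset.Icc 1 K, aoi (rrSet K k) t = K * (K + 1) / 2) := by
  refine ⟨sum_aoi_rrSet K t, fun h => ?_⟩
  rw [sum_aoi_rrSet, min_eq_right h, Nat.sub_self, Nat.zero_mul, Nat.add_zero]
end

section
/- Consider K UEs with nonnegative data rates R_1, …, R_K, a horizon of T slots, and a schedule given by a function σ : {1, …, T} → {1, …, K} (the UE scheduled in each slot, all scheduled transmissions successful), so that UE k's successful-update slot set is σ^{-1}(k). Let k* be a UE with R_{k*} ≥ R_j for all j, suppose σ(t₀) = j ≠ k* for some slot t₀, and let σ' agree with σ everywhere except σ'(t₀) = k*. Denote by A_i and A'_i the AoI sequences of UE i under σ and σ' respectively. Then: (a) Σ_{t=1}^{T} R_{σ'(t)} ≥ Σ_{t=1}^{T} R_{σ(t)}; (b) A'_{k*}(t) ≤ A_{k*}(t) for all t, and A'_i(t) = A_i(t) for all t and all i ∉ {j, k*}. Consequently, if σ satisfies (1/T) Σ_{t=1}^{T} A_i(t) ≤ A_max for every UE i, and σ' satisfies (1/T) Σ_{t=1}^{T} A'_j(t) ≤ A_max for the displaced UE j, then σ' satisfies (1/T)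 Σ_{t=1}^{T} A'_i(t) ≤ A_max for every UE i while achieving a sum rate at least as large as σ. -/
/-- The successful-update slot set of UE `k` under the schedule `σ` over horizon `T`
(one UE scheduled per slot, every scheduled transmission successful). -/
def schedSet (T : ℕ) {K : ℕ} (σ : ℕ → Fin K) (k : Fin K) : Set ℕ :=
  {t | 1 ≤ t ∧ t ≤ T ∧ σ t = k}

theorem aoi_antitone {S S' : Set ℕ} (h : S ⊆ S') (t : ℕ) : aoi S' t ≤ aoi S t := by
  induction t with
  | zero => simp [aoi]
  | succ t ih =>
    by_cases hS : t + 1 ∈ S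
    · simp [aoi, hS, h hS]
    · by_cases hS' : t + 1 ∈ S'
      · simp [aoi, hS, hS']
      · simpa [aoi, hS, hS'] using ih

theorem schedSet_subset_update (T : ℕ) {K : ℕ} (σ : ℕ → Fin K) (k : Fin K) (t₀ : ℕ) :
    schedSet T σ k ⊆ schedSet T (Function.update σ t₀ k) k := by
  rintro t ⟨h1, hT, hk⟩
  refine ⟨h1, hT, ?_⟩
  by_cases h : t = t₀
  · simp [h]
  · simpa [h] using hk

theorem schedSet_update_of_ne (T : ℕ) {K : ℕ} (σ : ℕ → Fin K) {i k : Fin K} {t₀ : ℕ}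
    (hσ : i ≠ σ t₀) (hk : i ≠ k) :
    schedSet T (Function.update σ t₀ k) i = schedSet T σ i := by
  ext t
  by_cases h : t = t₀
  · subst h
    simp [schedSet, hσ.symm, hk.symm]
  · simp [schedSet, h]

/-- **Scheduling Phase II exchange step.** Replacing the UE `j` scheduled in slot
`t₀` by a maximum-rate UE `k*`: (a) does not decrease the sum rate; (b) does not
increase the AoI of `k*` at any time and leaves the AoI of every other UE
`i ∉ {j, k*}` unchanged; consequently, if the original schedule met every UE's
average-AoI constraint and the displaced UE `j` still meets it after the exchange,
then the new schedule meets every UE's constraint with a sum rate at least as large. -/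
theorem stmt13 {K : ℕ} (T : ℕ) (hT : 0 < T) (R : Fin K → ℝ) (hR : ∀ i, 0 ≤ R i)
    (σ : ℕ → Fin K) (kstar j : Fin K) (hkstar : ∀ i, R i ≤ R kstar)
    (t₀ : ℕ) (ht₀1 : 1 ≤ t₀) (ht₀T : t₀ ≤ T) (hσt₀ : σ t₀ = j) (hjk : j ≠ kstar)
    (σ' : ℕ → Fin K) (hσ' : σ' = Function.update σ t₀ kstar)
    (Amax : ℝ) (hAmax : 0 < Amax) :
    (∑ t ∈ Finset.Icc 1 T, R (σ' t) ≥ ∑ t ∈ Finset.Icc 1 T, R (σ t)) ∧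
    (∀ t : ℕ, aoi (schedSet T σ' kstar) t ≤ aoi (schedSet T σ kstar) t) ∧
    (∀ i : Fin K, i ≠ j → i ≠ kstar →
      ∀ t : ℕ, aoi (schedSet T σ' i) t = aoi (schedSet T σ i) t) ∧
    ((∀ i : Fin K, (∑ t ∈ Finset.Icc 1 T, (aoi (schedSet T σ i) t : ℝ)) / T ≤ Amax) →
      (∑ t ∈ Finset.Icc 1 T, (aoi (schedSet T σ' j) t : ℝ)) / T ≤ Amax →
      (∀ i : Fin K, (∑ t ∈ Finset.Icc 1 T, (aoi (schedSet T σ' i) t : ℝ)) / T ≤ Amax) ∧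
        ∑ t ∈ Finset.Icc 1 T, R (σ' t) ≥ ∑ t ∈ Finset.Icc 1 T, R (σ t)) := by
  subst hσ' hσt₀
  have hrate : ∑ t ∈ Finset.Icc 1 T, R (Function.update σ t₀ kstar t) ≥
      ∑ t ∈ Finset.Icc 1 T, R (σ t) := by
    refine Finset.sum_le_sum fun t _ => ?_
    by_cases h : t = t₀
    · simpa [h] using hkstar (σ t₀)
    · simp [h]
  have hstar := aoi_antitone (schedSet_subset_update T σ kstar t₀)
  refine ⟨hrate, hstar, fun i hi hk t => by rw [schedSet_update_of_ne T σ hi hk],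
    fun hσ hj => ⟨fun i => ?_, hrate⟩⟩
  by_cases hi : i = σ t₀
  · exact hi ▸ hj
  by_cases hk : i = kstar
  · subst hk
    refine le_trans ?_ (hσ i)
    gcongr with t _
    exact hstar t
  · rw [schedSet_update_of_ne T σ hi hk]
    exact hσ i
end
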